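/- Let α ∈ ℝ and γ ∈ (1/2,1] with α + γ + 1 ≥ 0, let w : [0,1] → ℝ^d be continuous with K^w_{α,γ} < ∞, let x₀ ∈ ℝ^d, and let (b_n) be bounded continuous vector fields, Lipschitz in the space variable, with M := sup_n N_{α+γ+1}(b_n) < ∞. Let x^n be continuous solutions of x^n_t = x₀ + ∫₀^t b_n(u, x^n_u) du + w_t on [0,1]. Then there is a constant C depending only on α, γ, d such that sup_n K^{x^n}_{α+γ,γ} ≤ C K^w_{α,γ} (1 + M^γ) < ∞. -/

import Mathlib

open MeasureTheory Filter Topology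
open scoped ENNReal NNReal

noncomputable section

abbrev Euc (d : ℕ) : Type := EuclideanSpace ℝ (Fin d)

/-- `Y^w_{s,t}(ω,ξ) = ∫_s^t exp(i ξ·w_u + i ω u) du`. -/
def Yint {d : ℕ} (w : ℝ → Euc d) (s t ω : ℝ) (ξ : Euc d) : ℂ :=
  ∫ u in s..t, Complex.exp (Complex.I * Complex.ofReal (inner ℝ ξ (w u) + ω * u))

/-- The averaging constant `K^w_{α,γ}`. -/
def avgK {d : ℕ} (w : ℝ → Euc d) (α γ : ℝ) : ℝ≥0∞ :=
  ⨆ (s : ℝ) (t : ℝ) (_ : 0 ≤ s) (_ : s < t) (_ : t ≤ 1) (ω : ℝ) (ξ : Euc d),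
    ENNReal.ofReal (‖Yint w s t ω ξ‖ /
      ((1 + ‖ξ‖) ^ α * (1 + Real.sqrt (Real.log (1 + |ω|))) * (t - s) ^ γ))

/-- The norm `N_α` of a space-time vector field given through its Fourier transform `bhat`. -/
def FLnorm (d : ℕ) (α : ℝ) (bhat : ℝ × Euc d → Fin d → ℂ) : ℝ≥0∞ :=
  ∫⁻ p : ℝ × Euc d, ENNReal.ofReal (‖bhat p‖ * (1 + ‖p.2‖) ^ α *
    (1 + Real.sqrt (Real.log (1 + |p.1|))))

/-- The vector field `b(t,x)` recovered from its space-time Fourier transform. -/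
def fieldOf {d : ℕ} (bhat : ℝ × Euc d → Fin d → ℂ) (t : ℝ) (x : Euc d) : Euc d :=
  (EuclideanSpace.equiv (Fin d) ℝ).symm fun i =>
    ∫ p : ℝ × Euc d, (bhat p i * Complex.exp (Complex.I * Complex.ofReal (p.1 * t + inner ℝ p.2 x))).re

/-- The averaged vector field `σ^w_{[s,t]} b`, defined through the Fourier representation. -/
def sigmaAvg {d : ℕ} (w : ℝ → Euc d) (bhat : ℝ × Euc d → Fin d → ℂ) (s t : ℝ) (x : Euc d) :
    Euc d :=
  (EuclideanSpace.equiv (Fin d) ℝ).symm fun i =>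
    ∫ p : ℝ × Euc d, (bhat p i * Yint w s t p.1 p.2 *
      Complex.exp (Complex.I * Complex.ofReal (inner ℝ p.2 x))).re

/-- Partitions of the interval `[s,t]`. -/
structure IntervalPartition (s t : ℝ) where
  n : ℕ
  pts : ℕ → ℝ
  first : pts 0 = s
  last : pts n = t
  mono : ∀ i, i < n → pts i ≤ pts (i + 1)

/-- The mesh of the partition is smaller than `δ`. -/
def IntervalPartition.MeshLt {s t : ℝ} (P : IntervalPartition s t) (δ : ℝ) : Prop :=
  ∀ i, i < P.n → P.pts (i + 1) - P.pts i < δ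

/-- Riemann sums `Σ_i (G_{t_{i+1}} - G_{t_i})(f_{t_i})` of the nonlinear Young integral. -/
def RiemannSum {V W : Type*} [AddCommGroup W] (G : ℝ → V → W) (f : ℝ → V)
    {s t : ℝ} (P : IntervalPartition s t) : W :=
  ∑ i ∈ Finset.range P.n, (G (P.pts (i + 1)) (f (P.pts i)) - G (P.pts i) (f (P.pts i)))

/-- `L` is the nonlinear Young integral `∫_s^t G_{du}(f_u)`: the Riemann sums converge to `L`
as the mesh of the partition tends to `0`. -/
def HasYoungIntegral {V W : Type*} [NormedAddCommGroup W] (G : ℝ → V → W) (f : ℝ → V)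
    (s t : ℝ) (L : W) : Prop :=
  ∀ ε > 0, ∃ δ > 0, ∀ P : IntervalPartition s t, P.MeshLt δ → ‖RiemannSum G f P - L‖ < ε

/-- Riemann sums `Σ_i (σ^w_{[t_i,t_{i+1}]} b)(θ_{t_i})`. -/
def sigmaRiemannSum {d : ℕ} (w : ℝ → Euc d) (bhat : ℝ × Euc d → Fin d → ℂ)
    (θ : ℝ → Euc d) {s t : ℝ} (P : IntervalPartition s t) : Euc d :=
  ∑ i ∈ Finset.range P.n, sigmaAvg w bhat (P.pts i) (P.pts (i + 1)) (θ (P.pts i))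

/-- `L = ∫_s^t (σ^w_{du} b)(θ_u)` as a limit of Riemann sums. -/
def HasSigmaIntegral {d : ℕ} (w : ℝ → Euc d) (bhat : ℝ × Euc d → Fin d → ℂ)
    (θ : ℝ → Euc d) (s t : ℝ) (L : Euc d) : Prop :=
  ∀ ε > 0, ∃ δ > 0, ∀ P : IntervalPartition s t, P.MeshLt δ → ‖sigmaRiemannSum w bhat θ P - L‖ < ε

/-- `θ` solves the Young equation `θ_t = x₀ + ∫_0^t (σ^w_{du} b)(θ_u)` on `[0,1]`. -/
def SolvesSigmaYoung {d : ℕ} (w : ℝ → Euc d) (bhat : ℝ × Euc d → Fin d → ℂ)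
    (x₀ : Euc d) (θ : ℝ → Euc d) : Prop :=
  θ 0 = x₀ ∧ ∀ t ∈ Set.Icc (0 : ℝ) 1, HasSigmaIntegral w bhat θ 0 t (θ t - x₀)

/-- `γ`-Hölder continuity on `[0,1]`. -/
def HolderOnIcc {E : Type*} [NormedAddCommGroup E] (γ : ℝ) (f : ℝ → E) : Prop :=
  ∃ C : ℝ, ∀ s ∈ Set.Icc (0 : ℝ) 1, ∀ t ∈ Set.Icc (0 : ℝ) 1, ‖f t - f s‖ ≤ C * |t - s| ^ γ

/-- Covariance of the fractional Brownian motion of Hurst index `H`. -/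
def fbmCov (H : ℝ) (s t : ℝ) : ℝ := (s ^ (2 * H) + t ^ (2 * H) - |t - s| ^ (2 * H)) / 2

/-- `W` is a `d`-dimensional fractional Brownian motion of Hurst parameter `H` with continuous
sample paths: the coordinates are independent centered Gaussian processes with the fBm
covariance, expressed by asking every finite linear combination to be Gaussian. -/
def IsFBM {Ω : Type*} [MeasureSpace Ω] (d : ℕ) (H : ℝ) (W : Ω → ℝ → Euc d) : Prop :=
  (∀ ω, ContinuousOn (W ω) (Set.Icc 0 1)) ∧
  (∀ t, Measurable fun ω => W ω t) ∧
  (∀ ω, W ω 0 = 0) ∧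
  ∀ (n : ℕ) (c : Fin n → ℝ) (t : Fin n → ℝ) (j : Fin n → Fin d),
    (∀ k, t k ∈ Set.Icc (0 : ℝ) 1) →
    Measure.map (fun ω => ∑ k, c k * W ω (t k) (j k)) (volume : Measure Ω) =
      ProbabilityTheory.gaussianReal 0
        (Real.toNNReal (∑ k, ∑ l, c k * c l *
          (if j k = j l then fbmCov H (t k) (t l) else 0)))

/-- `R^w_λ = (∫_0^1 exp(λ |w_u|²) du)^{1/λ}`. -/
def Rconst {d : ℕ} (lam : ℝ) (w : ℝ → Euc d) : ℝ≥0∞ :=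
  (∫⁻ u in Set.Icc (0 : ℝ) 1, ENNReal.ofReal (Real.exp (lam * ‖w u‖ ^ 2))) ^ (1 / lam)

/-- `S^w_λ`. -/
def Sconst {d : ℕ} (H lam : ℝ) (w : ℝ → Euc d) : ℝ≥0∞ :=
  (∑' n : ℕ, ∑' m : ℕ, ∑ k ∈ Finset.range (2 ^ n), ∑' q : ℤ × (Fin d → ℤ),
    ENNReal.ofReal (
      (2 : ℝ) ^ (-(2 * (n : ℝ)) - (m : ℝ) * ((d : ℝ) + 2)) *
      (1 + |(q.1 : ℝ) / 2 ^ m|) ^ (-(2 : ℝ)) *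
      (1 + ‖(EuclideanSpace.equiv (Fin d) ℝ).symm (fun i => (q.2 i : ℝ) / 2 ^ m)‖) ^
        (-((d : ℝ) + 1)) *
      Real.exp (lam * 2 ^ n *
        (1 + ‖(EuclideanSpace.equiv (Fin d) ℝ).symm (fun i => (q.2 i : ℝ) / 2 ^ m)‖) ^ (1 / H) *
        ‖Yint w ((k : ℝ) / 2 ^ n) (((k : ℝ) + 1) / 2 ^ n) ((q.1 : ℝ) / 2 ^ m)
          ((EuclideanSpace.equiv (Fin d) ℝ).symm (fun i => (q.2 i : ℝ) / 2 ^ m))‖ ^ 2))) ^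
  (1 / lam)

/-- `Q^w_λ = √(log S^w_λ) + √(log R^w_λ)`. -/
def Qconst {d : ℕ} (H lam : ℝ) (w : ℝ → Euc d) : ℝ :=
  Real.sqrt (Real.log (Sconst H lam w).toReal) + Real.sqrt (Real.log (Rconst lam w).toReal)

/-- A first-order bound for an oscillatory integral against an amplitude of class `C¹`. -/
theorem norm_integral_mul_le_of_primitive_le {f f' g : ℝ → ℂ} {a b B Λ : ℝ}
    (hf : ∀ u, HasDerivAt f (f' u) u) (hf'c : Continuous f') (hg : Continuous g)
    (hab : a ≤ b) (hf1 : ∀ u, ‖f u‖ ≤ 1) (hf' : ∀ u, ‖f' u‖ ≤ Λ)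
    (hB : ∀ v ∈ Set.Icc a b, ‖∫ u in a..v, g u‖ ≤ B) :
    ‖∫ u in a..b, f u * g u‖ ≤ B * (1 + Λ * (b - a)) := by
  have hB0 : 0 ≤ B := (norm_nonneg _).trans (hB b ⟨hab, le_rfl⟩)
  have hparts := intervalIntegral.integral_mul_deriv_eq_deriv_mul (a := a) (b := b)
    (u := f) (v := fun v => ∫ u in a..v, g u) (u' := f') (v' := g)
    (fun u _ => hf u)
    (fun u _ => intervalIntegral.integral_hasDerivAt_right (hg.intervalIntegrable _ _)
      (hg.stronglyMeasurableAtFilter _ _) hg.continuousAt)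
    (hf'c.intervalIntegrable _ _) (hg.intervalIntegrable _ _)
  rw [hparts]
  have hrem : ‖∫ u in a..b, f' u * ∫ v in a..u, g v‖ ≤ Λ * B * |b - a| := by
    refine intervalIntegral.norm_integral_le_of_norm_le_const fun u hu => ?_
    rw [Set.uIoc_of_le hab] at hu
    rw [norm_mul]
    exact mul_le_mul (hf' u) (hB u ⟨hu.1.le, hu.2⟩) (norm_nonneg _)
      ((norm_nonneg _).trans (hf' u))
  rw [abs_of_nonneg (sub_nonneg.2 hab)] at hrem
  have hbdry : ‖f b * ∫ u in a..b, g u‖ ≤ B := by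
    rw [norm_mul]
    calc ‖f b‖ * ‖∫ u in a..b, g u‖ ≤ 1 * B :=
          mul_le_mul (hf1 b) (hB b ⟨hab, le_rfl⟩) (norm_nonneg _) zero_le_one
      _ = B := one_mul B
  rw [intervalIntegral.integral_same, mul_zero, sub_zero]
  calc _ ≤ _ := norm_sub_le _ _
    _ ≤ B + Λ * B * (b - a) := add_le_add hbdry hrem
    _ = _ := by ring

/-- If the primitive of `g` is `γ`-Hölder with constant `A` and `f` is bounded by `1` and
`Λ`-Lipschitz, then the primitive of `f * g` is `γ`-Hölder with constant of order
`A * (1 + Λ) ^ (1 - γ)`. -/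
theorem norm_integral_mul_le_of_holder {f f' g : ℝ → ℂ} {s t A Λ γ : ℝ}
    (hf : ∀ u, HasDerivAt f (f' u) u) (hf'c : Continuous f') (hg : Continuous g)
    (hst : s ≤ t) (hst1 : t - s ≤ 1) (hγ : 0 ≤ γ) (hγ1 : γ ≤ 1) (hA : 0 ≤ A)
    (hf1 : ∀ u, ‖f u‖ ≤ 1) (hf' : ∀ u, ‖f' u‖ ≤ Λ)
    (hgA : ∀ a b, s ≤ a → a ≤ b → b ≤ t → ‖∫ u in a..b, g u‖ ≤ A * (b - a) ^ γ) :
    ‖∫ u in s..t, f u * g u‖ ≤ 2 * A * (1 + Λ) ^ (1 - γ) * (t - s) ^ γ := by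
  have hΛ : 0 ≤ Λ := (norm_nonneg _).trans (hf' 0)
  have hfc : Continuous f := continuous_iff_continuousAt.2 fun u => (hf u).continuousAt
  set N : ℕ := ⌊Λ⌋₊ + 1 with hN
  have hNpos : (0 : ℝ) < N := by positivity
  have hΛN : Λ ≤ N := by rw [hN]; push_cast; exact (Nat.lt_floor_add_one Λ).le
  have hNΛ : (N : ℝ) ≤ 1 + Λ := by
    rw [hN]; push_cast; linarith [Nat.floor_le hΛ]
  set h : ℝ := (t - s) / N with hh
  have hh0 : 0 ≤ h := div_nonneg (sub_nonneg.2 hst) hNpos.le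
  have hNh : N * h = t - s := by rw [hh]; field_simp
  have hΛh : Λ * h ≤ 1 := by nlinarith [mul_le_mul_of_nonneg_right hΛN hh0]
  have hsum := intervalIntegral.sum_integral_adjacent_intervals
    (μ := volume) (f := fun u => f u * g u) (a := fun k : ℕ => s + k * h) (n := N)
    (fun k _ => (hfc.mul hg).intervalIntegrable _ _)
  have hend : s + N * h = t := by rw [hNh]; ring
  simp only [Nat.cast_zero, zero_mul, add_zero, hend] at hsum
  rw [← hsum]
  have hpiece : ∀ k ∈ Finset.range N,
      ‖∫ u in (s + k * h)..(s + (k + 1 : ℕ) * h), f u * g u‖ ≤ 2 * (A * h ^ γ) := by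
    intro k hk
    have hk' : ((k + 1 : ℕ) : ℝ) ≤ N := by exact_mod_cast Finset.mem_range.1 hk
    have hlen : s + (k + 1 : ℕ) * h - (s + k * h) = h := by push_cast; ring
    have hle : s + k * h ≤ s + (k + 1 : ℕ) * h := by linarith
    have hright : s + (k + 1 : ℕ) * h ≤ t := by
      linarith [mul_le_mul_of_nonneg_right hk' hh0]
    have hAh : 0 ≤ A * h ^ γ := mul_nonneg hA (Real.rpow_nonneg hh0 _)
    calc _ ≤ A * h ^ γ * (1 + Λ * (s + (k + 1 : ℕ) * h - (s + k * h))) := by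
          refine norm_integral_mul_le_of_primitive_le hf hf'c hg hle hf1 hf' fun v hv => ?_
          refine (hgA _ v (by have := mul_nonneg k.cast_nonneg hh0; linarith) hv.1
            (hv.2.trans hright)).trans ?_
          gcongr
          · linarith [hv.1]
          · linarith [hv.2]
      _ ≤ A * h ^ γ * 2 := by
          rw [hlen]; exact mul_le_mul_of_nonneg_left (by linarith) hAh
      _ = _ := by ring
  refine (norm_sum_le _ _).trans ((Finset.sum_le_sum hpiece).trans ?_)
  rw [Finset.sum_const, Finset.card_range, nsmul_eq_mul, hh,
    Real.div_rpow (sub_nonneg.2 hst) hNpos.le]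
  have hpow : (N : ℝ) / N ^ γ = N ^ (1 - γ) := by
    rw [Real.rpow_sub hNpos, Real.rpow_one]
  calc (N : ℝ) * (2 * (A * ((t - s) ^ γ / N ^ γ))) = 2 * A * (N / N ^ γ) * (t - s) ^ γ := by ring
    _ = 2 * A * N ^ (1 - γ) * (t - s) ^ γ := by rw [hpow]
    _ ≤ _ := by
      have : (0 : ℝ) ≤ (t - s) ^ γ := Real.rpow_nonneg (sub_nonneg.2 hst) _
      have : (0 : ℝ) ≤ 1 - γ := by linarith
      gcongr

/-- A field whose Fourier transform has finite norm of nonnegative order is bounded. -/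
theorem norm_fieldOf_le {d : ℕ} {β : ℝ} (hβ : 0 ≤ β) {bhat : ℝ × Euc d → Fin d → ℂ}
    (hb : FLnorm d β bhat ≠ ⊤) (t : ℝ) (x : Euc d) :
    ‖fieldOf bhat t x‖ ≤ √d * (FLnorm d β bhat).toReal := by
  have hcoord : ∀ i, ‖fieldOf bhat t x i‖ ≤ (FLnorm d β bhat).toReal := by
    intro i
    rw [← toReal_enorm]
    refine ENNReal.toReal_mono hb ?_
    refine (enorm_integral_le_lintegral_enorm _).trans (lintegral_mono fun p => ?_)
    rw [← ofReal_norm]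
    refine ENNReal.ofReal_le_ofReal ?_
    have hre : ‖(bhat p i * Complex.exp (Complex.I *
        Complex.ofReal (p.1 * t + inner ℝ p.2 x))).re‖ ≤ ‖bhat p‖ := by
      refine (Complex.abs_re_le_norm _).trans ?_
      rw [norm_mul, mul_comm Complex.I, Complex.norm_exp_ofReal_mul_I, mul_one]
      exact norm_le_pi_norm _ i
    refine hre.trans ?_
    have h1 : 1 ≤ (1 + ‖p.2‖) ^ β := Real.one_le_rpow (by linarith [norm_nonneg p.2]) hβ
    have h2 : 1 ≤ 1 + √(Real.log (1 + |p.1|)) := by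
      linarith [Real.sqrt_nonneg (Real.log (1 + |p.1|))]
    rw [mul_assoc]
    exact le_mul_of_one_le_right (norm_nonneg _) (one_le_mul_of_one_le_of_one_le h1 h2)
  have hM : 0 ≤ (FLnorm d β bhat).toReal := ENNReal.toReal_nonneg
  rw [EuclideanSpace.norm_eq]
  calc √(∑ i, ‖fieldOf bhat t x i‖ ^ 2) ≤ √(∑ _i : Fin d, (FLnorm d β bhat).toReal ^ 2) := by
        gcongr with i
        exact hcoord i
    _ = _ := by
      rw [Finset.sum_const, Finset.card_univ, Fintype.card_fin, nsmul_eq_mul,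
        Real.sqrt_mul d.cast_nonneg, Real.sqrt_sq hM]

theorem Yint_congr {d : ℕ} {w v : ℝ → Euc d} {s t : ℝ} (h : Set.EqOn w v (Set.uIcc s t))
    (ω : ℝ) (ξ : Euc d) : Yint w s t ω ξ = Yint v s t ω ξ :=
  intervalIntegral.integral_congr fun u hu => by simp only [h hu]

/-- The bound on the oscillatory integrals encoded by a finite averaging constant. -/
theorem norm_Yint_le {d : ℕ} {w : ℝ → Euc d} {α γ : ℝ} (hγ : 0 < γ) (hw : avgK w α γ ≠ ⊤)
    {s t : ℝ} (hs : 0 ≤ s) (hst : s ≤ t) (ht : t ≤ 1) (ω : ℝ) (ξ : Euc d) :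
    ‖Yint w s t ω ξ‖ ≤ (avgK w α γ).toReal *
      ((1 + ‖ξ‖) ^ α * (1 + √(Real.log (1 + |ω|)))) * (t - s) ^ γ := by
  rcases hst.eq_or_lt with rfl | hlt
  · simp [Yint, Real.zero_rpow hγ.ne']
  have hle : ENNReal.ofReal (‖Yint w s t ω ξ‖ /
      ((1 + ‖ξ‖) ^ α * (1 + √(Real.log (1 + |ω|))) * (t - s) ^ γ)) ≤ avgK w α γ :=
    le_iSup_of_le s <| le_iSup_of_le t <| le_iSup_of_le hs <| le_iSup_of_le hlt <|
      le_iSup_of_le ht <| le_iSup_of_le ω <| le_iSup_of_le ξ le_rfl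
  rw [ENNReal.ofReal_le_iff_le_toReal hw, div_le_iff₀] at hle
  · rwa [mul_assoc]
  · have := sub_pos.2 hlt
    positivity

/-- Averaging constants are stable under adding a Lipschitz perturbation to the path, at the
cost of a loss of `1 - γ` in the frequency. -/
theorem norm_Yint_add_primitive_le {d : ℕ} {w g : ℝ → Euc d} {α γ Λ : ℝ}
    (hγ : 0 < γ) (hγ1 : γ ≤ 1) (hwc : Continuous w) (hgc : Continuous g)
    (hw : avgK w α γ ≠ ⊤) (hg : ∀ u, ‖g u‖ ≤ Λ) (x₀ : Euc d)
    {s t : ℝ} (hs : 0 ≤ s) (hst : s ≤ t) (ht : t ≤ 1) (ω : ℝ) (ξ : Euc d) :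
    ‖Yint (fun u => x₀ + (∫ v in (0 : ℝ)..u, g v) + w u) s t ω ξ‖ ≤
      2 * ((avgK w α γ).toReal * ((1 + ‖ξ‖) ^ α * (1 + √(Real.log (1 + |ω|))))) *
        (1 + ‖ξ‖ * Λ) ^ (1 - γ) * (t - s) ^ γ := by
  set φ : ℝ → ℝ := fun u => inner ℝ ξ (x₀ + ∫ v in (0 : ℝ)..u, g v) with hφ
  have hφd : ∀ u, HasDerivAt φ (inner ℝ ξ (g u)) u := by
    intro u
    have hθ : HasDerivAt (fun u => x₀ + ∫ v in (0 : ℝ)..u, g v) (g u) u :=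
      (intervalIntegral.integral_hasDerivAt_right (hgc.intervalIntegrable _ _)
        (hgc.stronglyMeasurableAtFilter _ _) hgc.continuousAt).const_add x₀
    simpa using (hasDerivAt_const u ξ).inner ℝ hθ
  have hφc : Continuous φ := continuous_iff_continuousAt.2 fun u => (hφd u).continuousAt
  have hfd : ∀ u, HasDerivAt (fun u => Complex.exp ((φ u : ℂ) * Complex.I))
      (Complex.exp ((φ u : ℂ) * Complex.I) * (((inner ℝ ξ (g u) : ℝ) : ℂ) * Complex.I)) u :=
    fun u => ((hφd u).ofReal_comp.mul_const Complex.I).cexp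
  have hYc : Continuous fun u : ℝ =>
      Complex.exp (Complex.I * Complex.ofReal (inner ℝ ξ (w u) + ω * u)) := by
    fun_prop
  have hsplit : Yint (fun u => x₀ + (∫ v in (0 : ℝ)..u, g v) + w u) s t ω ξ =
      ∫ u in s..t, Complex.exp ((φ u : ℂ) * Complex.I) *
        Complex.exp (Complex.I * Complex.ofReal (inner ℝ ξ (w u) + ω * u)) := by
    refine intervalIntegral.integral_congr fun u _ => ?_
    simp only [hφ]
    rw [← Complex.exp_add, inner_add_right ξ (x₀ + _)]
    push_cast
    ring_nf
  rw [hsplit]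
  refine norm_integral_mul_le_of_holder hfd (by fun_prop) hYc hst (by linarith) hγ.le hγ1
    (by positivity) (fun u => (Complex.norm_exp_ofReal_mul_I _).le) (fun u => ?_)
    (fun a b ha hab hb => norm_Yint_le hγ hw (hs.trans ha) hab (hb.trans ht) ω ξ)
  rw [norm_mul, Complex.norm_exp_ofReal_mul_I, one_mul, norm_mul, Complex.norm_I, mul_one,
    Complex.norm_real]
  exact (norm_inner_le_norm _ _).trans (mul_le_mul_of_nonneg_left (hg u) (norm_nonneg _))

theorem avgK_congr {d : ℕ} {w v : ℝ → Euc d} (h : Set.EqOn w v (Set.Icc 0 1)) (α γ : ℝ) :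
    avgK w α γ = avgK v α γ := by
  unfold avgK
  refine iSup_congr fun s => iSup_congr fun t => iSup_congr fun hs => iSup_congr fun hst =>
    iSup_congr fun ht => iSup_congr fun ω => iSup_congr fun ξ => ?_
  rw [Yint_congr (h.mono _)]
  rw [Set.uIcc_of_le hst.le]
  exact Set.Icc_subset_Icc hs ht

theorem one_add_mul_rpow_one_sub_le {γ r c M : ℝ} (hγ : 1 / 2 < γ) (hγ1 : γ ≤ 1)
    (hr : 0 ≤ r) (hc : 0 ≤ c) (hM : 0 ≤ M) :
    (1 + r * (c * M)) ^ (1 - γ) ≤ (1 + c) * (1 + r) ^ γ * (1 + M ^ γ) := by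
  have hγ0 : 0 ≤ γ := by linarith
  calc (1 + r * (c * M)) ^ (1 - γ) ≤ (1 + r * (c * M)) ^ γ :=
        Real.rpow_le_rpow_of_exponent_le (by linarith [show 0 ≤ r * (c * M) by positivity])
          (by linarith)
    _ ≤ ((1 + c) * (1 + r) * (1 + M)) ^ γ := by
        gcongr
        have : 0 ≤ c * r + c * M + r * M + c + r + M := by positivity
        linarith
    _ = (1 + c) ^ γ * (1 + r) ^ γ * (1 + M) ^ γ := by
        rw [Real.mul_rpow (by positivity) (by positivity),
          Real.mul_rpow (by positivity) (by positivity)]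
    _ ≤ _ := by
        gcongr
        · exact Real.rpow_le_self_of_one_le (by linarith) hγ1
        · simpa using Real.rpow_add_le_add_rpow zero_le_one hM hγ0 hγ1

/-- Uniform bound on the averaging constants of the approximating
solutions: if `M = sup_n N_{α+γ+1}(bₙ) < ∞` and `xⁿ` solve the ODEs with drifts `bₙ`,
then `sup_n K^{xⁿ}_{α+γ,γ} ≤ C K^w_{α,γ} (1 + M^γ) < ∞`, with `C = C(α,γ,d)`. -/
theorem statement11 (d : ℕ) (α γ : ℝ) (hγ : 1 / 2 < γ) (hγ1 : γ ≤ 1)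
    (hαγ : 0 ≤ α + γ + 1) :
    ∃ C : ℝ, 0 < C ∧
      ∀ w : ℝ → Euc d, ContinuousOn w (Set.Icc 0 1) → avgK w α γ < ⊤ →
      ∀ (x₀ : Euc d) (bnhat : ℕ → ℝ × Euc d → Fin d → ℂ),
      (∀ n, Continuous fun q : ℝ × Euc d => fieldOf (bnhat n) q.1 q.2) →
      (∀ n, ∃ M : ℝ, ∀ (t : ℝ) (x : Euc d), ‖fieldOf (bnhat n) t x‖ ≤ M) →
      (∀ n, ∃ L : ℝ≥0, ∀ t : ℝ, LipschitzWith L (fieldOf (bnhat n) t)) →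
      (⨆ n, FLnorm d (α + γ + 1) (bnhat n)) < ⊤ →
      ∀ xn : ℕ → ℝ → Euc d,
      (∀ n, ContinuousOn (xn n) (Set.Icc 0 1)) →
      (∀ n, ∀ t ∈ Set.Icc (0 : ℝ) 1,
        xn n t = x₀ + (∫ s in (0 : ℝ)..t, fieldOf (bnhat n) s (xn n s)) + w t) →
      ∀ n, avgK (xn n) (α + γ) γ ≤
        ENNReal.ofReal C * avgK w α γ * (1 + (⨆ m, FLnorm d (α + γ + 1) (bnhat m)) ^ γ) := by
  refine ⟨2 * (1 + √d), by positivity, ?_⟩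
  intro w hw hK x₀ bnhat hbc _ _ hM xn hxc hx n
  set M : ℝ := (⨆ m, FLnorm d (α + γ + 1) (bnhat m)).toReal with hMdef
  have hM0 : 0 ≤ M := ENNReal.toReal_nonneg
  have hγ0 : 0 < γ := by linarith
  have hFLle : FLnorm d (α + γ + 1) (bnhat n) ≤ ⨆ m, FLnorm d (α + γ + 1) (bnhat m) :=
    le_iSup (fun m => FLnorm d (α + γ + 1) (bnhat m)) n
  have hfield : ∀ t x, ‖fieldOf (bnhat n) t x‖ ≤ √d * M := fun t x =>
    (norm_fieldOf_le hαγ (hFLle.trans_lt hM).ne t x).trans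
      (mul_le_mul_of_nonneg_left (ENNReal.toReal_mono hM.ne hFLle) (Real.sqrt_nonneg _))
  set w' : ℝ → Euc d := Set.IccExtend zero_le_one ((Set.Icc (0 : ℝ) 1).domRestrict w) with hw'
  have hw'c : Continuous w' := (continuousOn_iff_continuous_domRestrict.1 hw).Icc_extend'
  have hw'eq : Set.EqOn w w' (Set.Icc 0 1) := fun u hu => by
    rw [hw', Set.IccExtend_of_mem _ _ hu, Set.domRestrict_apply]
  set x' : ℝ → Euc d := Set.IccExtend zero_le_one ((Set.Icc (0 : ℝ) 1).domRestrict (xn n)) with hx'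
  have hx'c : Continuous x' := (continuousOn_iff_continuous_domRestrict.1 (hxc n)).Icc_extend'
  have hx'eq : Set.EqOn (xn n) x' (Set.Icc 0 1) := fun u hu => by
    rw [hx', Set.IccExtend_of_mem _ _ hu, Set.domRestrict_apply]
  have hgc : Continuous fun u => fieldOf (bnhat n) u (x' u) :=
    (hbc n).comp (continuous_id.prodMk hx'c)
  have hxeq : Set.EqOn (xn n)
      (fun u => x₀ + (∫ v in (0 : ℝ)..u, fieldOf (bnhat n) v (x' v)) + w' u)
      (Set.Icc 0 1) := by
    intro u hu
    have hint : ∫ v in (0 : ℝ)..u, fieldOf (bnhat n) v (xn n v) =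
        ∫ v in (0 : ℝ)..u, fieldOf (bnhat n) v (x' v) := by
      refine intervalIntegral.integral_congr fun v hv => ?_
      rw [Set.uIcc_of_le hu.1] at hv
      simp only [hx'eq ⟨hv.1, hv.2.trans hu.2⟩]
    simp only [hx n u hu, hint, hw'eq hu]
  rw [avgK_congr hxeq, avgK_congr hw'eq]
  rw [avgK_congr hw'eq] at hK
  have hbound : ENNReal.ofReal (2 * (1 + √d)) * avgK w' α γ *
      (1 + (⨆ m, FLnorm d (α + γ + 1) (bnhat m)) ^ γ) =
      ENNReal.ofReal (2 * (1 + √d) * (avgK w' α γ).toReal * (1 + M ^ γ)) := by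
    rw [ENNReal.ofReal_mul (q := 1 + M ^ γ) (by positivity),
      ENNReal.ofReal_mul (q := (avgK w' α γ).toReal) (by positivity),
      ENNReal.ofReal_toReal hK.ne, ENNReal.ofReal_add zero_le_one (by positivity),
      ENNReal.ofReal_one, ← ENNReal.ofReal_rpow_of_nonneg hM0 hγ0.le,
      ENNReal.ofReal_toReal hM.ne]
  rw [hbound]
  refine iSup_le fun s => iSup_le fun t => iSup_le fun hs => iSup_le fun hst => iSup_le fun ht =>
    iSup_le fun ω => iSup_le fun ξ => ENNReal.ofReal_le_ofReal ?_
  have hts : 0 < t - s := sub_pos.2 hst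
  rw [div_le_iff₀ (by positivity)]
  refine (norm_Yint_add_primitive_le hγ0 hγ1 hw'c hgc hK.ne (fun u => hfield _ _) x₀
    hs hst.le ht ω ξ).trans ?_
  have hloss := one_add_mul_rpow_one_sub_le hγ hγ1 (norm_nonneg ξ) (Real.sqrt_nonneg d) hM0
  calc _ ≤ 2 * ((avgK w' α γ).toReal * ((1 + ‖ξ‖) ^ α * (1 + √(Real.log (1 + |ω|))))) *
        ((1 + √d) * (1 + ‖ξ‖) ^ γ * (1 + M ^ γ)) * (t - s) ^ γ := by gcongr
    _ = _ := by
      rw [Real.rpow_add (by positivity : (0 : ℝ) < 1 + ‖ξ‖) α γ]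
      ring

end
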